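/- Suppose K is a field of characteristic p > 0 which is immediately algebraically closed (IAC) and Artin-Schreier closed (every polynomial X^p − X − a with a ∈ K has a root in K). Then K is valuationally algebraically closed (VAC). -/

import Mathlib

open Polynomial

universe u v

/-- A valuation on a field is *nontrivial* if `v x ≠ 1` (multiplicative notation,
corresponding to `v x ≠ 0` in the additive notation) for some nonzero `x`. -/
def IsNontrivialValuation {K : Type*} {Γ : Type*} [Field K]
    [LinearOrderedCommGroupWithZero Γ] (v : Valuation K Γ) : Prop :=
  ∃ x : K, x ≠ 0 ∧ v x ≠ 1

/-- The value group `vK = v(Kˣ)` of a valuation is divisible: every `γ ∈ vK` has `n`-th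
roots in `vK` for every `n ≥ 1` (written multiplicatively, i.e. `nδ = γ` additively). -/
def HasDivisibleValueGroup {K : Type*} {Γ : Type*} [Field K]
    [LinearOrderedCommGroupWithZero Γ] (v : Valuation K Γ) : Prop :=
  ∀ x : K, x ≠ 0 → ∀ n : ℕ, 1 ≤ n → ∃ y : K, y ≠ 0 ∧ v y ^ n = v x

/-- The residue field `Kv` of a valuation is algebraically closed. -/
def HasAlgClosedResidueField {K : Type*} {Γ : Type*} [Field K]
    [LinearOrderedCommGroupWithZero Γ] (v : Valuation K Γ) : Prop :=
  IsAlgClosed (IsLocalRing.ResidueField v.valuationSubring)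

/-- A field `K` is *immediately algebraically closed* (IAC) if for every nontrivial
valuation `v` on `K`, the residue field `Kv` is algebraically closed and the value
group `vK` is divisible. -/
def IsIAC (K : Type u) [Field K] : Prop :=
  ∀ (Γ : Type u) (_ : LinearOrderedCommGroupWithZero Γ) (v : Valuation K Γ),
    IsNontrivialValuation v → HasAlgClosedResidueField v ∧ HasDivisibleValueGroup v

/-- Given a field embedding `f : K →+* L` and a valuation `w` on `L`, `K` is *dense in `L`
with respect to `w`* if for every `a ∈ L` and every `γ = w c ∈ wL` (`c ≠ 0`) there is
`b ∈ K` with `w (a - b) < γ` (multiplicatively; `w (a - b) > γ` in additive notation). -/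
def DenseInWrt {K L : Type*} {Γ : Type*} [Field K] [Field L]
    [LinearOrderedCommGroupWithZero Γ] (f : K →+* L) (w : Valuation L Γ) : Prop :=
  ∀ a : L, ∀ c : L, c ≠ 0 → ∃ b : K, w (a - f b) < w c

/-- A field `K` is *valuationally algebraically closed* (VAC) if for every nontrivial
valuation `w` on its algebraic closure, `K` is dense in the algebraic closure
with respect to `w`. -/
def IsVAC (K : Type u) [Field K] : Prop :=
  ∀ (Γ : Type u) (_ : LinearOrderedCommGroupWithZero Γ)
    (w : Valuation (AlgebraicClosure K) Γ), IsNontrivialValuation w →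
      DenseInWrt (algebraMap K (AlgebraicClosure K)) w

/-- In characteristic `p`, an automorphism of order `p` maps some element `α` to `α + 1`. -/
theorem exists_apply_eq_add_one {E M : Type*} [Field E] [Field M] [Algebra E M] (p : ℕ)
    [Fact p.Prime] [CharP E p] (σ : M ≃ₐ[E] M) (hσ : σ ≠ 1) (hσp : σ ^ p = 1) :
    ∃ α : M, σ α = α + 1 := by
  have : CharP (Module.End E M) p :=
    charP_of_injective_algebraMap (algebraMap E (Module.End E M)).injective p
  let S : Module.End E M := σ.toLinearMap
  have hSp : S ^ p = 1 := by
    ext x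
    have h : ∀ n : ℕ, (S ^ n) x = (σ ^ n) x := by
      intro n
      induction n with
      | zero => simp
      | succ n ih => rw [pow_succ', pow_succ', Module.End.mul_apply, ih]; rfl
    rw [h, hσp]; rfl
  have hnil : ∃ k, (S - 1) ^ k = 0 := ⟨p, by
    rw [sub_pow_char_of_commute p (Commute.one_right S), hSp, one_pow, sub_self]⟩
  classical
  obtain ⟨k, hk, hmin⟩ : ∃ k, (S - 1) ^ k = 0 ∧ ∀ m < k, (S - 1) ^ m ≠ 0 :=
    ⟨Nat.find hnil, Nat.find_spec hnil, fun m hm => Nat.find_min hnil hm⟩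
  rcases k with _ | _ | k
  · simp at hk
  · rw [zero_add, pow_one, sub_eq_zero] at hk
    exact (hσ (AlgEquiv.ext fun x => LinearMap.congr_fun hk x)).elim
  · obtain ⟨y, hy⟩ : ∃ y, ((S - 1) ^ (k + 1)) y ≠ 0 := by
      by_contra! h
      exact hmin (k + 1) (by lia) (LinearMap.ext h)
    set z := ((S - 1) ^ k) y with hz
    have hez : ((S - 1) ^ (k + 1)) y = σ z - z := by
      rw [pow_succ', Module.End.mul_apply]; rfl
    have he : σ (σ z - z) = σ z - z := by
      have : ((S - 1) ^ (k + 2)) y = 0 := by rw [hk]; rfl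
      rw [pow_succ', Module.End.mul_apply, hez] at this
      exact sub_eq_zero.mp this
    rw [hez] at hy
    refine ⟨z / (σ z - z), ?_⟩
    rw [map_div₀, he]
    field_simp
    ring

/-- An Artin-Schreier closed field has no Galois extension of degree `p`. -/
theorem finrank_ne_of_artinSchreierClosed {E M : Type*} [Field E] [Field M] [Algebra E M] (p : ℕ)
    [Fact p.Prime] [CharP E p] [FiniteDimensional E M] [IsGalois E M]
    (hAS : ∀ a : E, ∃ x : E, x ^ p - x = a) : Module.finrank E M ≠ p := by
  intro hp
  have : CharP M p := charP_of_injective_algebraMap (algebraMap E M).injective p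
  have hcard : Nat.card (M ≃ₐ[E] M) = p := (IsGalois.card_aut_eq_finrank E M).trans hp
  have : Nontrivial (M ≃ₐ[E] M) :=
    Finite.one_lt_card_iff_nontrivial.mp (hcard ▸ (Fact.out : p.Prime).one_lt)
  obtain ⟨σ, hσ⟩ := exists_ne (1 : M ≃ₐ[E] M)
  obtain ⟨α, hα⟩ := exists_apply_eq_add_one p σ hσ (hcard ▸ pow_card_eq_one')
  have hfix : ∀ y : M, σ y = y → y ∈ (⊥ : IntermediateField E M) := by
    intro y hy
    rw [IsGalois.mem_bot_iff_fixed]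
    intro f
    obtain ⟨n, rfl⟩ := Subgroup.mem_zpowers_iff.mp (mem_zpowers_of_prime_card hcard hσ (g' := f))
    have hs : σ ∈ MulAction.stabilizer (M ≃ₐ[E] M) y := hy
    exact Subgroup.zpow_mem _ hs n
  obtain ⟨b, hb⟩ := IntermediateField.mem_bot.mp (hfix (α ^ p - α) (by
    rw [map_sub, map_pow, hα, add_pow_char, one_pow]; ring))
  obtain ⟨x, hx⟩ := hAS b
  have hroot : (α - algebraMap E M x) ^ p = α - algebraMap E M x := by
    have : algebraMap E M x ^ p - algebraMap E M x = α ^ p - α := by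
      rw [← hb, ← hx, map_sub, map_pow]
    rw [sub_pow_char]
    linear_combination -this
  have hmem := (Subfield.mem_bot_iff_pow_eq_self M p).mpr hroot
  have hle : (⊥ : Subfield M) ≤ (⊥ : IntermediateField E M).toSubfield := bot_le
  obtain ⟨c, hc⟩ := IntermediateField.mem_bot.mp (hle hmem)
  have h1 : σ (algebraMap E M c + algebraMap E M x) = algebraMap E M c + algebraMap E M x := by
    rw [map_add, σ.commutes, σ.commutes]
  rw [hc, sub_add_cancel, hα] at h1
  exact one_ne_zero (add_eq_left.mp h1)

theorem IsGalois.finrank_fixedField_eq_index {E M : Type*} [Field E] [Field M] [Algebra E M]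
    [FiniteDimensional E M] [IsGalois E M] (H : Subgroup (M ≃ₐ[E] M)) :
    Module.finrank E (IntermediateField.fixedField H) = H.index := by
  have h := Module.finrank_mul_finrank E (IntermediateField.fixedField H) M
  rw [IntermediateField.finrank_fixedField_eq_card H, ← IsGalois.card_aut_eq_finrank E M,
    ← H.index_mul_card] at h
  exact Nat.eq_of_mul_eq_mul_right Nat.card_pos h

/-- A perfect Artin-Schreier closed field of characteristic `p` is algebraically closed if it has
no proper finite extension of degree prime to `p`. -/
theorem isAlgClosed_of_artinSchreierClosed {E : Type*} [Field E] [PerfectField E] (p : ℕ)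
    [Fact p.Prime] [CharP E p] (hAS : ∀ a : E, ∃ x : E, x ^ p - x = a)
    (htame : ∀ (F : IntermediateField E (AlgebraicClosure E)), FiniteDimensional E F →
      ¬ p ∣ Module.finrank E F → Module.finrank E F = 1) : IsAlgClosed E := by
  refine IsAlgClosed.of_exists_root _ fun f hf hirr ↦ ?_
  have : IsGalois E f.SplittingField :=
    IsGalois.of_separable_splitting_field (PerfectField.separable_of_irreducible hirr)
  let e : f.SplittingField →ₐ[E] AlgebraicClosure E := IsAlgClosed.lift
  obtain ⟨P⟩ := (inferInstance : Nonempty (Sylow p (f.SplittingField ≃ₐ[E] f.SplittingField)))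
  have hidx : Module.finrank E
      (IntermediateField.fixedField (P : Subgroup (f.SplittingField ≃ₐ[E] f.SplittingField))) =
      (P : Subgroup (f.SplittingField ≃ₐ[E] f.SplittingField)).index :=
    IsGalois.finrank_fixedField_eq_index _
  have hone : (P : Subgroup (f.SplittingField ≃ₐ[E] f.SplittingField)).index = 1 := by
    let F := IntermediateField.fixedField (P : Subgroup (f.SplittingField ≃ₐ[E] f.SplittingField))
    have he : Module.finrank E (F.map e) = Module.finrank E F :=
      (IntermediateField.equivMap F e).toLinearEquiv.finrank_eq.symm
    have hfd : FiniteDimensional E (F.map e) :=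
      (IntermediateField.equivMap F e).toLinearEquiv.finiteDimensional
    rw [← hidx, ← he]
    exact htame _ hfd (by rw [he, hidx]; exact P.not_dvd_index)
  obtain ⟨n, hn⟩ := P.isPGroup'.exists_card_eq
  rw [Subgroup.index_eq_one.mp hone, Subgroup.card_top] at hn
  rcases n with _ | m
  · rw [pow_zero, IsGalois.card_aut_eq_finrank] at hn
    obtain ⟨x, hx⟩ := (SplittingField.splits f).exists_eval_eq_zero
      (by rw [degree_map]; exact (degree_pos_of_irreducible hirr).ne')
    have hx' : x ∈ (⊥ : Subalgebra E f.SplittingField) := by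
      rw [Subalgebra.bot_eq_top_of_finrank_eq_one hn]; trivial
    obtain ⟨y, rfl⟩ := Algebra.mem_bot.mp hx'
    refine ⟨y, (algebraMap E f.SplittingField).injective ?_⟩
    rwa [eval_map, eval₂_at_apply, ← map_zero (algebraMap E f.SplittingField)] at hx
  · exfalso
    obtain ⟨H, hH⟩ := Sylow.exists_subgroup_card_pow_prime p (n := m)
      (hn ▸ pow_dvd_pow p m.le_succ)
    have hHidx : H.index = p := by
      have := H.index_mul_card
      rw [hn, hH, pow_succ'] at this
      exact Nat.eq_of_mul_eq_mul_right (pow_pos (Fact.out : p.Prime).pos m) this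
    have : H.Normal := Subgroup.normal_of_index_eq_minFac_card (by
      rw [hHidx, hn, (Fact.out : p.Prime).pow_minFac m.succ_ne_zero])
    refine finrank_ne_of_artinSchreierClosed (M := IntermediateField.fixedField H) p hAS ?_
    rw [IsGalois.finrank_fixedField_eq_index, hHidx]

theorem norm_natCast_eq_one_of_not_dvd {E : Type*} [NormedField E] (p : ℕ) [Fact p.Prime]
    [CharP E p] {n : ℕ} (hn : ¬ p ∣ n) : ‖(n : E)‖ = 1 := by
  have h : (n : ZMod p) ≠ 0 := fun h => hn ((ZMod.natCast_eq_zero_iff n p).mp h)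
  have h1 := congrArg (ZMod.castHom (dvd_refl p) E) (ZMod.pow_card_sub_one_eq_one h)
  rw [map_pow, map_natCast, map_one] at h1
  have h2 := congrArg norm h1
  rw [norm_pow, norm_one] at h2
  exact (pow_eq_one_iff_of_nonneg (norm_nonneg _)
    (Nat.sub_ne_zero_of_lt (Fact.out : p.Prime).one_lt)).mp h2

theorem norm_trace_le_spectralNorm {E F : Type*} [NormedField E] [IsUltrametricDist E] [Field F]
    [Algebra E F] [FiniteDimensional E F] (y : F) :
    ‖Algebra.trace E F y‖ ≤ spectralNorm E F y := by
  rw [trace_eq_finrank_mul_minpoly_nextCoeff, norm_mul, norm_neg]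
  have hd : 0 < (minpoly E y).natDegree := minpoly.natDegree_pos (Algebra.IsIntegral.isIntegral y)
  have hc : ‖(minpoly E y).nextCoeff‖ ≤ spectralNorm E F y := by
    rw [nextCoeff_of_natDegree_pos hd]
    have h := le_ciSup (spectralValueTerms_bddAbove (minpoly E y)) ((minpoly E y).natDegree - 1)
    rw [spectralValueTerms_of_lt_natDegree _ (by lia), Nat.cast_sub (by lia)] at h
    simpa [spectralNorm, spectralValue] using h
  exact (mul_le_of_le_one_left (norm_nonneg _) (IsUltrametricDist.norm_natCast_le_one E _)).trans hc

/-- A complete ultrametric field of characteristic `p` with divisible value group and algebraically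
closed residue field has no proper finite extension of degree prime to `p`. -/
theorem finrank_eq_one_of_not_dvd {E : Type*} [NontriviallyNormedField E] [CompleteSpace E]
    [IsUltrametricDist E] (p : ℕ) [Fact p.Prime] [CharP E p]
    (hdiv : ∀ x : E, x ≠ 0 → ∀ n : ℕ, 1 ≤ n → ∃ y : E, ‖y‖ ^ n = ‖x‖)
    (hres : ∀ f : E[X], f.Monic → 0 < f.natDegree → (∀ i, ‖f.coeff i‖ ≤ 1) →
      ∃ b : E, ‖f.eval b‖ < 1)
    {F : Type*} [Field F] [Algebra E F] [FiniteDimensional E F]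
    (hn : ¬ p ∣ Module.finrank E F) : Module.finrank E F = 1 := by
  have hpow (y : F) : spectralNorm E F y ^ (minpoly E y).natDegree = ‖(minpoly E y).coeff 0‖ := by
    rw [spectralNorm.spectralNorm_eq_norm_coeff_zero_rpow, ← Real.rpow_natCast, ← Real.rpow_mul
      (norm_nonneg _), one_div_mul_cancel, Real.rpow_one]
    exact_mod_cast (minpoly.natDegree_pos (Algebra.IsIntegral.isIntegral y)).ne'
  have hint (y : F) : IsIntegral E y := Algebra.IsIntegral.isIntegral y
  have hnorm : ‖(Module.finrank E F : E)‖ = 1 := norm_natCast_eq_one_of_not_dvd p hn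
  have hn0 : (Module.finrank E F : E) ≠ 0 := norm_ne_zero_iff.mp (hnorm ▸ one_ne_zero)
  have htr (a : F) (ha : Algebra.trace E F a = 0) : a = 0 := by
    by_contra ha0
    obtain ⟨z, hz⟩ := hdiv ((minpoly E a).coeff 0) (minpoly.coeff_zero_ne_zero (hint a) ha0)
      _ (minpoly.natDegree_pos (hint a))
    have hza : ‖z‖ = spectralNorm E F a :=
      (pow_left_inj₀ (norm_nonneg _) (spectralNorm_nonneg _)
        (minpoly.natDegree_pos (hint a)).ne').mp (hz.trans (hpow a).symm)
    have hz0 : z ≠ 0 := by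
      rintro rfl
      rw [norm_zero, zero_pow (minpoly.natDegree_pos (hint a)).ne', eq_comm, norm_eq_zero] at hz
      exact minpoly.coeff_zero_ne_zero (hint a) ha0 hz
    set a' := z⁻¹ • a with ha'
    have hN : spectralNorm E F a' = 1 := by
      rw [ha', spectralNorm_smul _ (hint a).isAlgebraic, coe_nnnorm, norm_inv, ← hza,
        inv_mul_cancel₀ (norm_ne_zero_iff.mpr hz0)]
    have htr' : Algebra.trace E F a' = 0 := by rw [ha', map_smul, ha, smul_zero]
    obtain ⟨b, hb⟩ := hres (minpoly E a') (minpoly.monic (hint _))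
      (minpoly.natDegree_pos (hint _))
      ((spectralValue_le_one_iff (minpoly.monic (hint _))).mp hN.le)
    have hlt : spectralNorm E F (a' - algebraMap E F b) < 1 := by
      have h := hpow (a' - algebraMap E F b)
      rw [minpoly.sub_algebraMap, coeff_zero_eq_eval_zero, eval_comp, eval_add, eval_X, eval_C,
        zero_add] at h
      by_contra! h1
      exact (h ▸ hb).not_ge (one_le_pow₀ h1)
    have hb1 : 1 ≤ ‖b‖ := by
      by_contra! h
      have := isNonarchimedean_spectralNorm (K := E) (a' - algebraMap E F b) (algebraMap E F b)
      rw [sub_add_cancel, hN, spectralNorm_extends] at this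
      exact absurd this (max_lt hlt h).not_ge
    have := (norm_trace_le_spectralNorm _).trans_lt hlt
    rw [map_sub, htr', Algebra.trace_algebraMap, zero_sub, norm_neg, nsmul_eq_mul, norm_mul, hnorm,
      one_mul] at this
    exact this.not_ge hb1
  have hbot : (⊥ : Subalgebra E F) = ⊤ := by
    refine Algebra.eq_top_iff.mpr fun a => ?_
    refine Algebra.mem_bot.mpr ⟨(Module.finrank E F : E)⁻¹ * Algebra.trace E F a, ?_⟩
    refine (sub_eq_zero.mp (htr _ ?_)).symm
    rw [map_sub, Algebra.trace_algebraMap, nsmul_eq_mul, mul_inv_cancel_left₀ hn0, sub_self]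
  exact Subalgebra.bot_eq_top_iff_finrank_eq_one.mp hbot

theorem exists_pow_sub_self_eq_of_norm_lt_one {E : Type*} [NormedField E] [CompleteSpace E]
    (p : ℕ) [Fact p.Prime] [CharP E p] {a : E} (ha : ‖a‖ < 1) : ∃ x : E, x ^ p - x = a := by
  have hs : Summable fun n : ℕ => a ^ p ^ n := by
    refine Summable.of_norm_bounded (summable_geometric_of_lt_one (norm_nonneg a) ha) fun n => ?_
    rw [norm_pow]
    exact pow_le_pow_of_le_one (norm_nonneg a) ha.le
      (Nat.lt_pow_self (Fact.out : p.Prime).one_lt).le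
  have hp : (∑' n : ℕ, a ^ p ^ n) ^ p = ∑' n : ℕ, a ^ p ^ (n + 1) := by
    have := hs.map_tsum (frobenius E p) (continuous_pow p)
    simpa only [frobenius_def, ← pow_mul, ← pow_succ] using this
  have h0 := hs.tsum_eq_zero_add
  rw [pow_zero, pow_one, ← hp] at h0
  refine ⟨-∑' n : ℕ, a ^ p ^ n, ?_⟩
  rw [← zero_sub, sub_pow_char, zero_pow (Fact.out : p.Prime).ne_zero]
  linear_combination h0

theorem norm_pow_char_sub_pow_char {E : Type*} [NormedField E] (p : ℕ) [Fact p.Prime] [CharP E p]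
    (x y : E) : ‖x ^ p - y ^ p‖ = ‖x - y‖ ^ p := by
  rw [← sub_pow_char, norm_pow]

/-- A complete nontrivially normed ultrametric field that is Artin-Schreier closed is perfect: the
equations `Y ^ p - c ^ (n * (p - 1)) * Y = a` are solvable, and their solutions converge to a `p`-th
root of `a` when `‖c‖ < 1`. -/
theorem perfectField_of_artinSchreierClosed {E : Type*} [NontriviallyNormedField E]
    [CompleteSpace E] [IsUltrametricDist E] (p : ℕ) [Fact p.Prime] [CharP E p]
    (hAS : ∀ a : E, ∃ x : E, x ^ p - x = a) : PerfectField E := by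
  have hp1 : 1 < p := (Fact.out : p.Prime).one_lt
  suffices h : Function.Surjective (frobenius E p) by
    have := PerfectRing.ofSurjective E p h
    exact PerfectRing.toPerfectField E p
  intro a
  obtain ⟨c, hc0, hc1⟩ := NormedField.exists_norm_lt_one E
  have hc : c ≠ 0 := norm_pos_iff.mp hc0
  have hroot (n : ℕ) : ∃ y : E, y ^ p - (c ^ n) ^ (p - 1) * y = a := by
    obtain ⟨x, hx⟩ := hAS (a / (c ^ n) ^ p)
    refine ⟨x * c ^ n, ?_⟩
    have h : (c ^ n) ^ p ≠ 0 := pow_ne_zero _ (pow_ne_zero _ hc)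
    rw [eq_div_iff h] at hx
    rw [← hx, ← Nat.sub_add_cancel hp1.le, Nat.add_sub_cancel]
    ring
  choose y hy using hroot
  have hbound (n : ℕ) : ‖y n‖ ≤ max 1 ‖a‖ := by
    by_contra! h
    obtain ⟨h1, h2⟩ := max_lt_iff.mp h
    have hlt : ‖y n‖ < ‖y n‖ ^ p := lt_self_pow₀ h1 hp1
    have hle : ‖(c ^ n) ^ (p - 1) * y n‖ ≤ ‖y n‖ := by
      rw [norm_mul, norm_pow, norm_pow]
      exact mul_le_of_le_one_left (norm_nonneg _)
        (pow_le_one₀ (by positivity) (pow_le_one₀ hc0.le hc1.le))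
    have : ‖y n ^ p‖ ≤ max ‖a‖ ‖(c ^ n) ^ (p - 1) * y n‖ := by
      rw [sub_eq_iff_eq_add.mp (hy n)]
      exact IsUltrametricDist.norm_add_le_max _ _
    rw [norm_pow] at this
    exact absurd this (max_lt (h2.trans hlt) (hle.trans_lt hlt)).not_ge
  have hlim : Filter.Tendsto (fun n => y n ^ p) Filter.atTop (nhds a) := by
    rw [tendsto_iff_norm_sub_tendsto_zero]
    have h0 : Filter.Tendsto (fun n : ℕ => ‖c‖ ^ n * max 1 ‖a‖) Filter.atTop (nhds 0) := by
      simpa using (tendsto_pow_atTop_nhds_zero_of_lt_one hc0.le hc1).mul_const (max 1 ‖a‖)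
    refine squeeze_zero (fun _ => norm_nonneg _) (fun n => ?_) h0
    have : y n ^ p - a = (c ^ n) ^ (p - 1) * y n := by rw [← hy n]; ring
    rw [this, norm_mul, norm_pow, norm_pow]
    gcongr
    · exact pow_le_of_le_one (by positivity) (pow_le_one₀ hc0.le hc1.le) (by lia)
    · exact hbound n
  have hcauchy : CauchySeq y := by
    rw [Metric.cauchySeq_iff]
    intro ε hε
    obtain ⟨N, hN⟩ := Metric.cauchySeq_iff.mp hlim.cauchySeq (ε ^ p) (by positivity)
    refine ⟨N, fun m hm n hn => ?_⟩
    have := hN m hm n hn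
    rw [dist_eq_norm, norm_pow_char_sub_pow_char] at this
    rw [dist_eq_norm]
    exact lt_of_pow_lt_pow_left₀ p hε.le this
  obtain ⟨b, hb⟩ := cauchySeq_tendsto_of_complete hcauchy
  exact ⟨b, tendsto_nhds_unique (hb.pow p) hlim⟩

/-- Monic polynomials can be approximated coefficientwise by monic polynomials over a dense
subfield. -/
theorem exists_monic_norm_coeff_sub_lt {K E : Type*} [Field K] [NormedField E] (j : K →+* E)
    (hj : DenseRange j) {f : E[X]} (hf : f.Monic) {ε : ℝ} (hε : 0 < ε) :
    ∃ g : K[X], g.Monic ∧ g.natDegree = f.natDegree ∧ ∀ i, ‖f.coeff i - j (g.coeff i)‖ < ε := by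
  choose k hk using fun i => hj.exists_dist_lt (f.coeff i) hε
  have hdeg : (∑ i ∈ Finset.range f.natDegree, C (k i) * X ^ i : K[X]).degree <
      (f.natDegree : WithBot ℕ) := by
    rw [← Fin.sum_univ_eq_sum_range (fun i => C (k i) * X ^ i) f.natDegree]
    exact degree_sum_fin_lt _
  refine ⟨X ^ f.natDegree + ∑ i ∈ Finset.range f.natDegree, C (k i) * X ^ i,
    monic_X_pow_add hdeg, natDegree_eq_of_degree_eq_some ((degree_add_eq_left_of_degree_lt
      (by rwa [degree_X_pow])).trans (degree_X_pow _)), fun i => ?_⟩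
  simp only [coeff_add, finsetSum_coeff, coeff_X_pow, coeff_C_mul, mul_ite, mul_one, mul_zero,
    Finset.sum_ite_eq, Finset.mem_range]
  rcases lt_trichotomy i f.natDegree with h | h | h
  · rw [if_neg h.ne, if_pos h, zero_add, ← dist_eq_norm]
    exact hk i
  · rw [if_pos h, if_neg h.ge.not_gt, add_zero, map_one, h, hf.coeff_natDegree, sub_self, norm_zero]
    exact hε
  · rw [if_neg h.ne', if_neg h.le.not_gt, add_zero, map_zero, coeff_eq_zero_of_natDegree_lt h,
      sub_zero, norm_zero]
    exact hε

theorem norm_eval_lt_of_norm_coeff_lt {E : Type*} [NormedField E] [IsUltrametricDist E] {f : E[X]}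
    {b : E} (hb : ‖b‖ ≤ 1) (hf : ∀ i, ‖f.coeff i‖ < 1) : ‖f.eval b‖ < 1 := by
  rw [eval_eq_sum_range]
  obtain ⟨i, -, hi⟩ := IsUltrametricDist.exists_norm_finsetSum_le_of_nonempty
    (Finset.nonempty_range_add_one (n := f.natDegree)) (fun i => f.coeff i * b ^ i)
  refine hi.trans_lt ?_
  rw [norm_mul, norm_pow]
  exact (mul_le_of_le_one_right (norm_nonneg _) (pow_le_one₀ (norm_nonneg _) hb)).trans_lt (hf i)

/-- The completion of an Artin-Schreier closed ultrametric field of characteristic `p` with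
divisible value group and algebraically closed residue field is algebraically closed. -/
theorem isAlgClosed_of_denseRange {K E : Type*} [Field K] [NontriviallyNormedField E]
    [CompleteSpace E] [IsUltrametricDist E] (p : ℕ) [Fact p.Prime] [CharP K p] (j : K →+* E)
    (hj : DenseRange j) (hAS : ∀ a : K, ∃ x : K, x ^ p - x = a)
    (hdiv : ∀ x : K, x ≠ 0 → ∀ n : ℕ, 1 ≤ n → ∃ y : K, ‖j y‖ ^ n = ‖j x‖)
    (hres : ∀ f : K[X], f.Monic → 0 < f.natDegree → (∀ i, ‖j (f.coeff i)‖ ≤ 1) →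
      ∃ b : K, ‖j b‖ ≤ 1 ∧ ‖j (f.eval b)‖ < 1) : IsAlgClosed E := by
  have : CharP E p := charP_of_injective_ringHom j.injective p
  have hAS' : ∀ a : E, ∃ x : E, x ^ p - x = a := by
    intro a
    obtain ⟨k, hk⟩ := hj.exists_dist_lt a one_pos
    obtain ⟨x, rfl⟩ := hAS k
    rw [dist_eq_norm] at hk
    obtain ⟨z, hz⟩ := exists_pow_sub_self_eq_of_norm_lt_one p hk
    refine ⟨z + j x, ?_⟩
    rw [add_pow_char]
    rw [map_sub, map_pow] at hz
    linear_combination hz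
  have hdiv' : ∀ x : E, x ≠ 0 → ∀ n : ℕ, 1 ≤ n → ∃ y : E, ‖y‖ ^ n = ‖x‖ := by
    intro x hx n hn
    obtain ⟨k, hk⟩ := hj.exists_dist_lt x (norm_pos_iff.mpr hx)
    rw [dist_eq_norm] at hk
    have hkx : ‖j k‖ = ‖x‖ := by
      rw [norm_sub_rev, sub_eq_add_neg] at hk
      have := IsUltrametricDist.norm_eq_of_add_norm_lt_max
        (hk.trans_le ((norm_neg x).ge.trans (le_max_right _ _)))
      rwa [norm_neg] at this
    have hk0 : k ≠ 0 := by
      rintro rfl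
      rw [map_zero, norm_zero, eq_comm, norm_eq_zero] at hkx
      exact hx hkx
    obtain ⟨y, hy⟩ := hdiv k hk0 n hn
    exact ⟨j y, hy.trans hkx⟩
  have hres' : ∀ f : E[X], f.Monic → 0 < f.natDegree → (∀ i, ‖f.coeff i‖ ≤ 1) →
      ∃ b : E, ‖f.eval b‖ < 1 := by
    intro f hf hd hi
    obtain ⟨g, hg, hgd, hfg⟩ := exists_monic_norm_coeff_sub_lt j hj hf one_pos
    obtain ⟨b, hb, hgb⟩ := hres g hg (hgd ▸ hd) fun i => by
      have := IsUltrametricDist.norm_add_le_max (f.coeff i) (-(f.coeff i - j (g.coeff i)))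
      rw [norm_neg, ← sub_eq_add_neg, sub_sub_cancel] at this
      exact this.trans (max_le (hi i) (hfg i).le)
    refine ⟨j b, ?_⟩
    have h1 : ‖(f - g.map j).eval (j b)‖ < 1 :=
      norm_eval_lt_of_norm_coeff_lt hb fun i => by rw [coeff_sub, coeff_map]; exact hfg i
    have h2 : f.eval (j b) = (f - g.map j).eval (j b) + j (g.eval b) := by
      rw [eval_sub, eval_map_apply, sub_add_cancel]
    rw [h2]
    exact (IsUltrametricDist.norm_add_le_max _ _).trans_lt (max_lt h1 hgb)
  have := perfectField_of_artinSchreierClosed p hAS'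
  exact isAlgClosed_of_artinSchreierClosed p hAS' fun F _ hF =>
    finrank_eq_one_of_not_dvd p hdiv' hres' hF

/-- An Artin-Schreier closed field of characteristic `p` with divisible value group and
algebraically closed residue field is dense in every algebraic ultrametric extension. -/
theorem exists_norm_sub_algebraMap_lt {K L : Type*} [Field K] [NormedField L] [IsUltrametricDist L]
    [Algebra K L] [Algebra.IsAlgebraic K L] (p : ℕ) [Fact p.Prime] [CharP K p]
    (hnt : ∃ x : K, 1 < ‖algebraMap K L x‖) (hAS : ∀ a : K, ∃ x : K, x ^ p - x = a)
    (hdiv : ∀ x : K, x ≠ 0 → ∀ n : ℕ, 1 ≤ n →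
      ∃ y : K, ‖algebraMap K L y‖ ^ n = ‖algebraMap K L x‖)
    (hres : ∀ f : K[X], f.Monic → 0 < f.natDegree → (∀ i, ‖algebraMap K L (f.coeff i)‖ ≤ 1) →
      ∃ b : K, ‖algebraMap K L b‖ ≤ 1 ∧ ‖algebraMap K L (f.eval b)‖ < 1)
    (a : L) {ε : ℝ} (hε : 0 < ε) : ∃ b : K, ‖a - algebraMap K L b‖ < ε := by
  let c : L →+* UniformSpace.Completion L := UniformSpace.Completion.coeRingHom
  have hc : ∀ x, ‖c x‖ = ‖x‖ := UniformSpace.Completion.norm_coe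
  let i : K →+* UniformSpace.Completion L := c.comp (algebraMap K L)
  have : IsUltrametricDist (UniformSpace.Completion L) :=
    IsUltrametricDist.isUltrametricDist_of_forall_norm_natCast_le_one fun n => by
      rw [← map_natCast c, hc]
      exact IsUltrametricDist.norm_natCast_le_one L n
  let S : Subfield (UniformSpace.Completion L) := i.fieldRange.topologicalClosure
  have hiS : ∀ x, i x ∈ S := fun x => i.fieldRange.le_topologicalClosure ⟨x, rfl⟩
  let j : K →+* S := i.codRestrict S hiS
  have hji : ∀ x, ‖j x‖ = ‖algebraMap K L x‖ := fun x => hc _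
  let _ : NontriviallyNormedField S :=
    { SubfieldClass.toNormedField S with
      non_trivial := hnt.imp' j fun x hx => hx.trans_eq (hji x).symm }
  have : CompleteSpace S :=
    (Subfield.isClosed_topologicalClosure i.fieldRange).isComplete.completeSpace_coe
  have : IsUltrametricDist S := IsUltrametricDist.subtype _
  have hj : DenseRange j := by
    intro s
    rw [mem_closure_iff_nhds_basis Metric.nhds_basis_ball]
    intro δ hδ
    obtain ⟨_, ⟨x, rfl⟩, hx⟩ := Metric.mem_closure_iff.mp s.2 δ hδ
    exact ⟨j x, ⟨x, rfl⟩, by rw [Metric.mem_ball, dist_comm]; exact hx⟩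
  have : IsAlgClosed S := isAlgClosed_of_denseRange p j hj hAS
    (by simpa only [hji] using hdiv) (by simpa only [hji] using hres)
  have haS : c a ∈ S := by
    have hmon := minpoly.monic (Algebra.IsIntegral.isIntegral (R := K) a)
    have hroot : (((minpoly K a).map j).map S.subtype).IsRoot (c a) := by
      rw [map_map, show S.subtype.comp j = c.comp (algebraMap K L) from rfl, ← map_map]
      refine IsRoot.map ?_
      rw [IsRoot, eval_map_algebraMap, minpoly.aeval]
    obtain ⟨z, hz⟩ := (IsAlgClosed.splits ((minpoly K a).map j)).mem_range_of_isRoot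
      (hmon.map j).ne_zero hroot
    exact hz ▸ z.2
  obtain ⟨_, ⟨x, rfl⟩, hx⟩ := Metric.mem_closure_iff.mp haS ε hε
  refine ⟨x, ?_⟩
  rw [dist_eq_norm] at hx
  rw [← hc, map_sub]
  exact hx

/-- Monic integral polynomials have approximate roots when the residue field is algebraically
closed. -/
theorem HasAlgClosedResidueField.exists_map_eval_lt_one {K Γ : Type*} [Field K]
    [LinearOrderedCommGroupWithZero Γ] {v : Valuation K Γ} (hv : HasAlgClosedResidueField v)
    {f : K[X]} (hf : f.Monic) (hd : 0 < f.natDegree) (hi : ∀ i, v (f.coeff i) ≤ 1) :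
    ∃ b : K, v b ≤ 1 ∧ v (f.eval b) < 1 := by
  have := hv
  unfold HasAlgClosedResidueField at this
  have hl : f ∈ lifts v.valuationSubring.subtype :=
    (lifts_iff_coeff_lifts f).mpr fun i => ⟨⟨f.coeff i, hi i⟩, rfl⟩
  obtain ⟨g, rfl, hgd, hg⟩ := lifts_and_natDegree_eq_and_monic hl hf
  obtain ⟨r, hr⟩ := IsAlgClosed.exists_root (g.map (IsLocalRing.residue v.valuationSubring))
    (by rw [hg.degree_map, degree_eq_natDegree hg.ne_zero, hgd]; exact_mod_cast hd.ne')
  obtain ⟨b, rfl⟩ := IsLocalRing.residue_surjective r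
  rw [IsRoot, eval_map_apply, IsLocalRing.residue_eq_zero_iff] at hr
  refine ⟨b, b.2, ?_⟩
  have h : eval (b : K) (g.map v.valuationSubring.subtype) = (g.eval b : v.valuationSubring) :=
    eval_map_apply v.valuationSubring.subtype b
  rw [h]
  exact (v.isEquiv_valuation_valuationSubring.lt_one_iff_lt_one).mpr
    ((v.valuationSubring.valuation_lt_one_iff _).mp hr)

/-- A nontrivial valuation restricts to a nontrivial valuation below an algebraic extension. -/
theorem Valuation.exists_one_lt_map_algebraMap {K L Γ : Type*} [Field K] [Field L] [Algebra K L]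
    [Algebra.IsAlgebraic K L] [LinearOrderedCommGroupWithZero Γ] (w : Valuation L Γ)
    (hw : ∃ x, 1 < w x) : ∃ x : K, 1 < w (algebraMap K L x) := by
  by_contra! h
  obtain ⟨x, hx⟩ := hw
  refine hx.not_ge ?_
  let φ : K →+* w.integer := (algebraMap K L).codRestrict w.integer h
  obtain ⟨f, hf, hfx⟩ := Algebra.IsIntegral.isIntegral (R := K) x
  refine (Valuation.integer.integers w).mem_of_integral ⟨f.map φ, hf.map φ, ?_⟩
  rw [eval₂_map]
  exact hfx

/-- A nontrivial archimedean valuation is equivalent to a nonarchimedean absolute value. -/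
theorem Valuation.exists_absoluteValue_le_iff {L Γ : Type*} [Field L]
    [LinearOrderedCommGroupWithZero Γ] (v : Valuation L Γ) (hnt : ∃ x, 1 < v x)
    (harch : ∀ x y, 1 < v x → ∃ n : ℕ, v y ≤ v x ^ n) :
    ∃ N : AbsoluteValue L ℝ, IsNonarchimedean N ∧ ∀ x y, N x ≤ N y ↔ v x ≤ v y := by
  have : v.IsNontrivial := ⟨hnt.imp fun x hx => ⟨(zero_lt_one.trans hx).ne', hx.ne'⟩⟩
  have : MulArchimedean (MonoidWithZeroHom.ValueGroup₀ (.ofClass v)) := ⟨fun g h hh => by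
    obtain ⟨y, rfl⟩ := MonoidWithZeroHom.ValueGroup₀.restrict₀_surjective _ g
    obtain ⟨x, rfl⟩ := MonoidWithZeroHom.ValueGroup₀.restrict₀_surjective _ h
    simp only [← Valuation.restrict_def] at hh ⊢
    rw [← map_one v.restrict, Valuation.restrict_lt_iff, map_one] at hh
    obtain ⟨n, hn⟩ := harch x y hh
    exact ⟨n, by rwa [← map_pow, Valuation.restrict_le_iff, map_pow]⟩⟩
  obtain ⟨hv⟩ := Valuation.nonempty_rankOne_iff_mulArchimedean.mpr this
  refine ⟨{ toFun := v.norm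
            map_mul' := fun x y => by simp only [Valuation.norm_def, map_mul, NNReal.coe_mul]
            nonneg' := v.norm_nonneg
            eq_zero' := fun x => ⟨v.norm_eq_zero, ?_⟩
            add_le' := fun x y => (v.norm_add_le x y).trans
              (max_le_add_of_nonneg (v.norm_nonneg x) (v.norm_nonneg y)) },
    v.norm_add_le, fun x y => ?_⟩
  · rintro rfl
    simp only [Valuation.norm_def, map_zero, NNReal.coe_zero]
  · change v.norm x ≤ v.norm y ↔ _
    rw [Valuation.norm_def, Valuation.norm_def, NNReal.coe_le_coe,
      (Valuation.RankOne.strictMono v).le_iff_le, Valuation.restrict_le_iff]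

theorem denseInWrt_of_archimedean {K L Γ : Type*} [Field K] [Field L] [Algebra K L]
    [Algebra.IsAlgebraic K L] [LinearOrderedCommGroupWithZero Γ] (p : ℕ) [Fact p.Prime] [CharP K p]
    (v : Valuation L Γ) (hnt : ∃ x, 1 < v x) (harch : ∀ x y, 1 < v x → ∃ n : ℕ, v y ≤ v x ^ n)
    (hAS : ∀ a : K, ∃ x : K, x ^ p - x = a)
    (hdiv : HasDivisibleValueGroup (v.comap (algebraMap K L)))
    (hres : HasAlgClosedResidueField (v.comap (algebraMap K L))) :
    DenseInWrt (algebraMap K L) v := by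
  obtain ⟨N, hN, hNv⟩ := v.exists_absoluteValue_le_iff hnt harch
  have hlt : ∀ x y, N x < N y ↔ v x < v y := fun x y => by
    rw [← not_le, hNv, not_le]
  have hN1 : ∀ x, N x ≤ 1 ↔ v x ≤ 1 := fun x => by
    simpa only [map_one] using hNv x 1
  have hN1' : ∀ x, N x < 1 ↔ v x < 1 := fun x => by
    simpa only [map_one] using hlt x 1
  have h1N : ∀ x, 1 < N x ↔ 1 < v x := fun x => by
    simpa only [map_one] using hlt 1 x
  let _ : NormedField L := N.toNormedField
  have hnorm : ∀ x : L, ‖x‖ = N x := fun _ => rfl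
  have : IsUltrametricDist L := IsUltrametricDist.isUltrametricDist_of_isNonarchimedean_norm hN
  intro a c hc
  obtain ⟨b, hb⟩ := exists_norm_sub_algebraMap_lt p
    ((v.exists_one_lt_map_algebraMap (K := K) hnt).imp fun x => (h1N _).mpr) hAS
    (fun x hx n hn => by
      obtain ⟨y, -, hy⟩ := hdiv x hx n hn
      refine ⟨y, ?_⟩
      have hy' : v (algebraMap K L y ^ n) = v (algebraMap K L x) := by
        rw [map_pow]
        exact hy
      rw [← norm_pow]
      exact le_antisymm ((hNv _ _).mpr hy'.le) ((hNv _ _).mpr hy'.ge))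
    (fun f hf hd hi => by
      obtain ⟨b, hb, hfb⟩ := hres.exists_map_eval_lt_one hf hd fun i => (hN1 _).mp (hi i)
      exact ⟨b, (hN1 _).mpr hb, (hN1' _).mpr hfb⟩)
    a (N.pos hc)
  exact ⟨b, (hlt _ _).mp hb⟩

theorem IsIAC.comap_algebraMap {K : Type u} {L : Type v} {Γ : Type u} [Field K] [Field L]
    [Algebra K L] [Algebra.IsAlgebraic K L] [LinearOrderedCommGroupWithZero Γ] (h : IsIAC K)
    (w : Valuation L Γ) (hw : ∃ x, 1 < w x) :
    HasAlgClosedResidueField (w.comap (algebraMap K L)) ∧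
      HasDivisibleValueGroup (w.comap (algebraMap K L)) := by
  obtain ⟨x, hx⟩ := w.exists_one_lt_map_algebraMap (K := K) hw
  refine h Γ _ _ ⟨x, ?_, hx.ne'⟩
  rintro rfl
  rw [map_zero, map_zero] at hx
  exact not_lt_zero hx

section Coarsening

variable {L Γ : Type*} [Field L] [LinearOrderedCommGroupWithZero Γ] {w : Valuation L Γ}
  {A : ValuationSubring L}

theorem ValuationSubring.valuation_le_of_valuationSubring_le (hA : w.valuationSubring ≤ A) {x y : L}
    (h : w x ≤ w y) : A.valuation x ≤ A.valuation y := by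
  rcases eq_or_ne y 0 with rfl | hy
  · rw [map_zero, le_zero_iff, map_eq_zero] at h
    rw [h]
  · have hxy : x / y ∈ A := hA (by
      rw [Valuation.mem_valuationSubring_iff, map_div₀]
      exact div_le_one_of_le₀ h zero_le)
    rwa [← A.valuation_le_one_iff, map_div₀, div_le_one₀ (by simpa [zero_lt_iff] using hy)] at hxy

theorem ValuationSubring.lt_of_valuation_lt (hA : w.valuationSubring ≤ A) {x y : L}
    (h : A.valuation x < A.valuation y) : w x < w y :=
  lt_of_not_ge fun h' => h.not_ge (valuation_le_of_valuationSubring_le hA h')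

/-- The largest proper coarsening of `w` when the powers of `w c` are cofinal. -/
theorem Valuation.exists_le_valuationSubring_mem_iff_forall_pow_le (w : Valuation L Γ) {c : L}
    (hc : 1 < w c) : ∃ A : ValuationSubring L, w.valuationSubring ≤ A ∧
      ∀ x, x ∈ A ↔ ∀ n : ℕ, w x ^ n ≤ w c := by
  refine ⟨{ carrier := {x | ∀ n : ℕ, w x ^ n ≤ w c}
            mul_mem' := fun {x y} hx hy n => ?_
            one_mem' := fun n => by rw [map_one, one_pow]; exact hc.le
            add_mem' := fun {x y} hx hy n => ?_
            zero_mem' := fun n => ?_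
            neg_mem' := fun {x} hx n => by rw [Valuation.map_neg]; exact hx n
            mem_or_inv_mem' := fun x => ?_ }, fun x hx n => ?_, fun x => Iff.rfl⟩
  · rw [map_mul]
    rcases le_total (w x) (w y) with h | h
    · exact (pow_le_pow_left₀ zero_le (mul_le_mul_left h (w y)) n).trans
        (by rw [← sq, ← pow_mul]; exact hy _)
    · exact (pow_le_pow_left₀ zero_le (mul_le_mul_right h (w x)) n).trans
        (by rw [← sq, ← pow_mul]; exact hx _)
  · rcases le_max_iff.mp (w.map_add x y) with h | h
    · exact (pow_le_pow_left₀ zero_le h n).trans (hx n)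
    · exact (pow_le_pow_left₀ zero_le h n).trans (hy n)
  · exact (pow_le_one₀ zero_le (by simp)).trans hc.le
  · rcases w.valuationSubring.mem_or_inv_mem x with h | h
    · exact Or.inl fun n => (pow_le_one₀ zero_le h).trans hc.le
    · exact Or.inr fun n => (pow_le_one₀ zero_le h).trans hc.le
  · exact (pow_le_one₀ zero_le hx).trans hc.le

/-- The finest coarsening of `w` at which `c` is integral. -/
theorem Valuation.exists_le_valuationSubring_mem_iff_exists_le_pow (w : Valuation L Γ) {c : L}
    (hc : 1 < w c) : ∃ A : ValuationSubring L, w.valuationSubring ≤ A ∧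
      ∀ x, x ∈ A ↔ ∃ n : ℕ, w x ≤ w c ^ n := by
  refine ⟨{ carrier := {x | ∃ n : ℕ, w x ≤ w c ^ n}
            mul_mem' := ?_
            one_mem' := ⟨0, by simp⟩
            add_mem' := ?_
            zero_mem' := ⟨0, by simp⟩
            neg_mem' := fun {x} hx => by simpa only [Set.mem_ofPred_eq, Valuation.map_neg] using hx
            mem_or_inv_mem' := fun x => ?_ },
    fun x hx => ⟨0, by simpa using hx⟩, fun x => Iff.rfl⟩
  · rintro x y ⟨m, hm⟩ ⟨n, hn⟩
    exact ⟨m + n, by rw [map_mul, pow_add]; exact mul_le_mul' hm hn⟩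
  · rintro x y ⟨m, hm⟩ ⟨n, hn⟩
    refine ⟨max m n, (w.map_add x y).trans (max_le ?_ ?_)⟩
    · exact hm.trans (pow_le_pow_right₀ hc.le (le_max_left _ _))
    · exact hn.trans (pow_le_pow_right₀ hc.le (le_max_right _ _))
  · rcases w.valuationSubring.mem_or_inv_mem x with h | h
    · exact Or.inl ⟨0, by simpa using h⟩
    · exact Or.inr ⟨0, by simpa using h⟩

end Coarsening

/-- Density when `w` has a rank one coarsening. -/
theorem denseInWrt_of_exists_le_pow {K L Γ : Type u} [Field K] [Field L] [Algebra K L]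
    [Algebra.IsAlgebraic K L] [LinearOrderedCommGroupWithZero Γ] (p : ℕ) [Fact p.Prime] [CharP K p]
    (hIAC : IsIAC K) (hAS : ∀ a : K, ∃ x : K, x ^ p - x = a) (w : Valuation L Γ) {c : L}
    (hc : 1 < w c) (hcof : ∀ y, ∃ n : ℕ, w y ≤ w c ^ n) : DenseInWrt (algebraMap K L) w := by
  obtain ⟨A, hA, hmem⟩ := w.exists_le_valuationSubring_mem_iff_forall_pow_le hc
  have hnt : ∃ x, 1 < A.valuation x := by
    refine ⟨c, lt_of_not_ge fun h => ?_⟩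
    have h2 := (hmem c).mp ((A.valuation_le_one_iff c).mp h) 2
    exact h2.not_gt (lt_self_pow₀ hc one_lt_two)
  obtain ⟨hres, hdiv⟩ := hIAC.comap_algebraMap A.valuation hnt
  have hdense := denseInWrt_of_archimedean p A.valuation hnt (fun x y hx => by
    have hxA : x ∉ A := fun h => hx.not_ge ((A.valuation_le_one_iff x).mpr h)
    rw [hmem] at hxA
    push Not at hxA
    obtain ⟨n, hn⟩ := hxA
    obtain ⟨m, hm⟩ := hcof y
    refine ⟨n * m, ?_⟩
    rw [← map_pow]
    refine ValuationSubring.valuation_le_of_valuationSubring_le hA (hm.trans ?_)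
    rw [map_pow, pow_mul]
    exact pow_le_pow_left₀ zero_le hn.le m) hAS hdiv hres
  intro a d hd
  obtain ⟨b, hb⟩ := hdense a d hd
  exact ⟨b, ValuationSubring.lt_of_valuation_lt hA hb⟩

/-- When no element has cofinal powers, every monic polynomial has roots arbitrarily close to
`K`. -/
theorem exists_mem_aroots_map_sub_lt {K L Γ : Type u} [Field K] [Field L] [IsAlgClosed L]
    [Algebra K L] [Algebra.IsAlgebraic K L] [LinearOrderedCommGroupWithZero Γ] (hIAC : IsIAC K)
    (w : Valuation L Γ) (hw : ∃ x, 1 < w x)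
    (hcof : ∀ c, 1 < w c → ∃ y, ∀ n : ℕ, w c ^ n < w y) {f : K[X]} (hf : f.Monic)
    (hd : 0 < f.natDegree) {d : L} (hd0 : d ≠ 0) :
    ∃ a ∈ f.aroots L, ∃ b : K, w (a - algebraMap K L b) < w d := by
  classical
  obtain ⟨c, hc1, hcd, hci⟩ : ∃ c, 1 < w c ∧ w d⁻¹ ≤ w c ∧
      ∀ i, w (algebraMap K L (f.coeff i)) ≤ w c := by
    obtain ⟨x, hx⟩ := hw
    obtain ⟨c, -, hc⟩ := Finset.exists_max_image
      (insert x (insert d⁻¹ ((Finset.range (f.natDegree + 1)).image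
        fun i => algebraMap K L (f.coeff i)))) w ⟨x, Finset.mem_insert_self _ _⟩
    refine ⟨c, hx.trans_le (hc x (by simp)), hc _ (by simp), fun i => ?_⟩
    by_cases hi : i ≤ f.natDegree
    · refine hc _ (Finset.mem_insert_of_mem (Finset.mem_insert_of_mem
        (Finset.mem_image_of_mem _ (Finset.mem_range.mpr (Nat.lt_succ_of_le hi)))))
    · rw [coeff_eq_zero_of_natDegree_lt (not_le.mp hi), map_zero, map_zero]
      exact zero_le
  obtain ⟨A, hA, hmem⟩ := w.exists_le_valuationSubring_mem_iff_exists_le_pow hc1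
  obtain ⟨y, hy⟩ := hcof c hc1
  have hnt : ∃ x, 1 < A.valuation x := by
    refine ⟨y, lt_of_not_ge fun h => ?_⟩
    obtain ⟨n, hn⟩ := (hmem y).mp ((A.valuation_le_one_iff y).mp h)
    exact hn.not_gt (hy n)
  obtain ⟨b, -, hb⟩ := (hIAC.comap_algebraMap A.valuation hnt).1.exists_map_eval_lt_one hf hd
    fun i => (A.valuation_le_one_iff _).mpr ((hmem _).mpr ⟨1, by rw [pow_one]; exact hci i⟩)
  obtain ⟨a, ha, hba⟩ : ∃ a ∈ f.aroots L, A.valuation (algebraMap K L b - a) < 1 := by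
    by_contra! h
    refine hb.not_ge ?_
    rw [Valuation.comap_apply, ← eval_map_apply,
      (IsAlgClosed.splits (f.map (algebraMap K L))).eval_eq_prod_roots_of_monic (hf.map _),
      map_multiset_prod, Multiset.map_map]
    refine Multiset.one_le_prod_of_one_le fun x hx => ?_
    obtain ⟨a, ha, rfl⟩ := Multiset.mem_map.mp hx
    exact h a ha
  refine ⟨a, ha, b, ?_⟩
  have hcu : A.valuation c⁻¹ = 1 := by
    have h1 : A.valuation c ≤ 1 := (A.valuation_le_one_iff c).mpr ((hmem c).mpr ⟨1, by simp⟩)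
    have h2 : A.valuation 1 ≤ A.valuation c :=
      ValuationSubring.valuation_le_of_valuationSubring_le hA (by rw [map_one]; exact hc1.le)
    rw [map_one] at h2
    rw [map_inv₀, le_antisymm h1 h2, inv_one]
  rw [Valuation.map_sub_swap]
  refine (ValuationSubring.lt_of_valuation_lt hA (hba.trans_eq hcu.symm)).trans_le ?_
  rw [map_inv₀] at hcd ⊢
  exact inv_le_of_inv_le₀ (zero_lt_iff.mpr ((_root_.map_ne_zero w).mpr hd0)) hcd

/-- The elements approximated by `K` form an intermediate field. -/
theorem exists_intermediateField_mem_iff {K L Γ : Type*} [Field K] [Field L] [Algebra K L]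
    [Algebra.IsAlgebraic K L] [LinearOrderedCommGroupWithZero Γ] (w : Valuation L Γ) :
    ∃ C : IntermediateField K L, ∀ a, a ∈ C ↔
      ∀ d : L, d ≠ 0 → ∃ b : K, w (a - algebraMap K L b) < w d := by
  have hpos : ∀ d : L, d ≠ 0 → 0 < w d := fun d hd =>
    zero_lt_iff.mpr ((_root_.map_ne_zero w).mpr hd)
  let S : Subalgebra K L :=
    { carrier := {a | ∀ d : L, d ≠ 0 → ∃ b : K, w (a - algebraMap K L b) < w d}
      mul_mem' := by
        intro x y hx hy d hd
        rcases eq_or_ne x 0 with rfl | hx0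
        · exact ⟨0, by simpa using hpos d hd⟩
        obtain ⟨e, he⟩ := hy (d / x) (div_ne_zero hd hx0)
        have he' : w (x * (y - algebraMap K L e)) < w d := by
          rw [map_mul, mul_comm]
          rwa [map_div₀, lt_div_iff₀ (hpos x hx0)] at he
        rcases eq_or_ne e 0 with rfl | he0
        · exact ⟨0, by simpa using he'⟩
        have he0' : algebraMap K L e ≠ 0 := (_root_.map_ne_zero _).mpr he0
        obtain ⟨b, hb⟩ := hx (d / algebraMap K L e) (div_ne_zero hd he0')
        rw [map_div₀, lt_div_iff₀ (hpos _ he0'), ← map_mul] at hb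
        refine ⟨b * e, ?_⟩
        rw [show x * y - algebraMap K L (b * e) = x * (y - algebraMap K L e) +
          (x - algebraMap K L b) * algebraMap K L e by rw [map_mul]; ring]
        exact w.map_add_lt he' hb
      add_mem' := by
        intro x y hx hy d hd
        obtain ⟨b, hb⟩ := hx d hd
        obtain ⟨e, he⟩ := hy d hd
        refine ⟨b + e, ?_⟩
        rw [map_add, add_sub_add_comm]
        exact w.map_add_lt hb he
      algebraMap_mem' := fun b d hd => ⟨b, by simpa using hpos d hd⟩ }
  exact ⟨subalgebraEquivIntermediateField S, fun a => mem_subalgebraEquivIntermediateField⟩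

/-- Density when `w` has no rank one coarsening. -/
theorem denseInWrt_of_forall_exists_pow_lt {K L Γ : Type u} [Field K] [Field L] [IsAlgClosed L]
    [Algebra K L] [Algebra.IsAlgebraic K L] [LinearOrderedCommGroupWithZero Γ] (hIAC : IsIAC K)
    (w : Valuation L Γ) (hw : ∃ x, 1 < w x)
    (hcof : ∀ c, 1 < w c → ∃ y, ∀ n : ℕ, w c ^ n < w y) : DenseInWrt (algebraMap K L) w := by
  classical
  obtain ⟨C, hC⟩ := exists_intermediateField_mem_iff (K := K) w
  have : IsAlgClosure K C := IsAlgClosure.of_exists_root fun f hf hfi => by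
    suffices h : ∃ a ∈ f.aroots L, a ∈ C by
      obtain ⟨a, ha, haC⟩ := h
      refine ⟨⟨a, haC⟩, Subtype.ext ?_⟩
      rw [← IntermediateField.aeval_coe]
      exact (mem_aroots.mp ha).2
    by_contra! h
    have h' : ∀ a ∈ f.aroots L, ∃ d : L, d ≠ 0 ∧ ∀ b : K, w d ≤ w (a - algebraMap K L b) := by
      intro a ha
      simpa only [hC, not_forall, not_exists, not_lt, exists_prop] using h a ha
    choose! d hd0 hd using h'
    have hne : ((f.aroots L).toFinset).Nonempty := by
      obtain ⟨a, ha⟩ := IsAlgClosed.exists_aeval_eq_zero L f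
        (degree_pos_of_irreducible hfi).ne'
      exact ⟨a, Multiset.mem_toFinset.mpr (mem_aroots.mpr ⟨hf.ne_zero, ha⟩)⟩
    obtain ⟨e, he, hmin⟩ := Finset.exists_min_image _ (fun a => w (d a)) hne
    rw [Multiset.mem_toFinset] at he
    obtain ⟨a, ha, b, hb⟩ := exists_mem_aroots_map_sub_lt hIAC w hw hcof hf hfi.natDegree_pos
      (hd0 e he)
    exact (hb.trans_le (hmin a (Multiset.mem_toFinset.mpr ha))).not_ge (hd a ha b)
  have := IsAlgClosure.isAlgClosed K (K := C)
  intro a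
  obtain ⟨z, rfl⟩ := (IsAlgClosed.algebraMap_bijective_of_isIntegral (k := C) (K := L)).2 a
  exact (hC z).mp z.2

/-- An IAC field of characteristic `p > 0` that is Artin-Schreier closed
(every polynomial `X^p - X - a` with `a ∈ K` has a root in `K`) is VAC. -/
theorem isVAC_of_isIAC_artinSchreierClosed {K : Type u} [Field K]
    (p : ℕ) (hp : 0 < p) [CharP K p] (hIAC : IsIAC K)
    (hAS : ∀ a : K, ∃ x : K, x ^ p - x = a) : IsVAC K := by
  have : Fact p.Prime := ⟨(CharP.char_is_prime_or_zero K p).resolve_right hp.ne'⟩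
  intro Γ _ w ⟨x, hx0, hx1⟩
  have hw : ∃ x, 1 < w x := by
    rcases hx1.lt_or_gt with h | h
    · exact ⟨x⁻¹, by
        rwa [map_inv₀, one_lt_inv₀ (zero_lt_iff.mpr ((_root_.map_ne_zero w).mpr hx0))]⟩
    · exact ⟨x, h⟩
  by_cases hcof : ∃ c, 1 < w c ∧ ∀ y, ∃ n : ℕ, w y ≤ w c ^ n
  · obtain ⟨c, hc, hcof⟩ := hcof
    exact denseInWrt_of_exists_le_pow p hIAC hAS w hc hcof
  · push Not at hcof
    exact denseInWrt_of_forall_exists_pow_lt hIAC w hw hcof
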